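/- Let R = 𝔽₂[t, t⁻¹] and consider the R-linear maps d₂ : R² → R³ whose matrix has columns c₁ = (t³+t²+1, t³+t+1, t²+t) and c₂ = (t³+t+1, t²+t, t³+t²+1) (the mod-2 reductions of the Dehornoy–Lafont differential for G₁₂), and d₁ : R³ → R given by d₁(p,q,r) = (t+1)(p+q+r). Then d₁ ∘ d₂ = 0, d₂ is injective, and ker(d₁)/im(d₂) is isomorphic as an R-module to R/((t²+t+1)³); in particular the mod-2 Milnor-fiber torsion for G₁₂ is (t²+t+1)³ = Φ₃³ rather than Φ₆ ⊕ Φ₁₂. -/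

import Mathlib

open LaurentPolynomial

/-- The ring `R = 𝔽₂[t, t⁻¹]`. -/
abbrev RF := LaurentPolynomial (ZMod 2)

/-- First column `c₁ = (t³+t²+1, t³+t+1, t²+t)` of the mod-2 differential `d₂`. -/
noncomputable def colOne : RF × RF × RF := (T 3 + T 2 + 1, T 3 + T 1 + 1, T 2 + T 1)

/-- Second column `c₂ = (t³+t+1, t²+t, t³+t²+1)` of the mod-2 differential `d₂`. -/
noncomputable def colTwo : RF × RF × RF := (T 3 + T 1 + 1, T 2 + T 1, T 3 + T 2 + 1)

/-- `d₂ : R² → R³`, `(u, v) ↦ u·c₁ + v·c₂`. -/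
noncomputable def dtwo : RF × RF →ₗ[RF] RF × RF × RF :=
  LinearMap.coprod
    (LinearMap.toSpanSingleton RF (RF × RF × RF) colOne)
    (LinearMap.toSpanSingleton RF (RF × RF × RF) colTwo)

/-- `d₁ : R³ → R`, `(p, q, r) ↦ (t+1)(p+q+r)`. -/
noncomputable def done : RF × RF × RF →ₗ[RF] RF :=
  LinearMap.coprod (LinearMap.toSpanSingleton RF RF (T 1 + 1))
    (LinearMap.coprod (LinearMap.toSpanSingleton RF RF (T 1 + 1))
      (LinearMap.toSpanSingleton RF RF (T 1 + 1)))

theorem RF.T_one_add_one_ne_zero : (T 1 + 1 : RF) ≠ 0 := by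
  have h : (T 1 + 1 : RF) = (Polynomial.X + Polynomial.C 1 : Polynomial (ZMod 2)).toLaurent := by
    simp
  rw [h, Polynomial.toLaurent_ne_zero]
  exact Polynomial.X_add_C_ne_zero 1

theorem RF.toLaurent_cyclotomic_three :
    (Polynomial.cyclotomic 3 (ZMod 2)).toLaurent = (T 2 + T 1 + 1 : RF) := by
  simp [Polynomial.cyclotomic_three]

theorem RF.T_two_add_T_one_add_one_ne_zero : (T 2 + T 1 + 1 : RF) ≠ 0 := by
  rw [← RF.toLaurent_cyclotomic_three, Polynomial.toLaurent_ne_zero]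
  exact Polynomial.cyclotomic_ne_zero 3 _

theorem RF.two_eq_zero : (2 : RF) = 0 := by
  have h : (C (2 : ZMod 2) : RF) = 2 := map_ofNat C 2
  rw [← h, show (2 : ZMod 2) = 0 from rfl, map_zero]

theorem RF.T_two : (T 2 : RF) = T 1 ^ 2 := by simp [T_pow]

theorem RF.T_three : (T 3 : RF) = T 1 ^ 3 := by simp [T_pow]

theorem dtwo_apply (u v : RF) : dtwo (u, v) = u • colOne + v • colTwo := by
  simp [dtwo]

theorem done_apply (p q r : RF) : done (p, q, r) = (T 1 + 1) * (p + q + r) := by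
  simp only [done, LinearMap.coprod_apply, LinearMap.toSpanSingleton_apply, smul_eq_mul]
  ring

theorem mem_ker_done {p q r : RF} : (p, q, r) ∈ LinearMap.ker done ↔ p + q + r = 0 := by
  rw [LinearMap.mem_ker, done_apply, mul_eq_zero, or_iff_right RF.T_one_add_one_ne_zero]

theorem done_comp_dtwo : done.comp dtwo = 0 := by
  refine LinearMap.ext fun ⟨u, v⟩ => ?_
  have h2 := RF.two_eq_zero
  simp only [LinearMap.comp_apply, dtwo_apply, colOne, colTwo, Prod.smul_mk, Prod.mk_add_mk,
    done_apply, LinearMap.zero_apply, smul_eq_mul, RF.T_two, RF.T_three]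
  grind

theorem ker_dtwo : LinearMap.ker dtwo = ⊥ := by
  refine LinearMap.ker_eq_bot'.2 fun ⟨u, v⟩ h => ?_
  have h2 := RF.two_eq_zero
  have hD := pow_ne_zero 3 RF.T_two_add_T_one_add_one_ne_zero
  simp only [dtwo_apply, colOne, colTwo, Prod.smul_mk, Prod.mk_add_mk, smul_eq_mul,
    RF.T_two, RF.T_three, Prod.mk_eq_zero] at h hD
  obtain ⟨h₁, h₂, h₃⟩ := h
  generalize (T 1 : RF) = t at *
  have hu : u = 0 := by
    refine (mul_eq_zero.1 ?_).resolve_left hD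
    grind
  have hv : v = 0 := by
    subst hu
    grind
  rw [hu, hv, Prod.mk_zero_zero]

/-- The functional `(p, q, r) ↦ (t²+t)p + (t³+t+1)q`, which annihilates `colTwo` and sends `colOne`
to `(t²+t+1)³`. -/
noncomputable def annihilatorColTwo : RF × RF × RF →ₗ[RF] RF :=
  LinearMap.coprod (LinearMap.toSpanSingleton RF RF (T 2 + T 1))
    (LinearMap.coprod (LinearMap.toSpanSingleton RF RF (T 3 + T 1 + 1)) 0)

theorem annihilatorColTwo_apply (p q r : RF) :
    annihilatorColTwo (p, q, r) = (T 2 + T 1) * p + (T 3 + T 1 + 1) * q := by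
  simp [annihilatorColTwo, mul_comm]

theorem exists_mem_ker_done_annihilatorColTwo_eq (x : RF) :
    ∃ y ∈ LinearMap.ker done, annihilatorColTwo y = x := by
  have h2 := RF.two_eq_zero
  refine ⟨((T 1 + 1) * x, x, T 1 * x), mem_ker_done.2 ?_, ?_⟩
  · grind
  · rw [annihilatorColTwo_apply, RF.T_two, RF.T_three]
    generalize (T 1 : RF) = t at *
    grind

theorem mem_range_dtwo_iff {y : RF × RF × RF} (hy : y ∈ LinearMap.ker done) :
    y ∈ LinearMap.range dtwo ↔ (T 2 + T 1 + 1 : RF) ^ 3 ∣ annihilatorColTwo y := by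
  obtain ⟨p, q, r⟩ := y
  have h2 := RF.two_eq_zero
  have hr := mem_ker_done.1 hy
  simp only [LinearMap.mem_range, Prod.exists, dtwo_apply, annihilatorColTwo_apply, colOne, colTwo,
    Prod.smul_mk, Prod.mk_add_mk, smul_eq_mul, RF.T_two, RF.T_three, Prod.mk.injEq]
  generalize (T 1 : RF) = t at *
  constructor
  · rintro ⟨u, v, rfl, rfl, -⟩
    exact ⟨u, by grind⟩
  · rintro ⟨k, hk⟩
    refine ⟨k, (p + k * (t ^ 3 + t ^ 2 + 1)) + (t + 1) * (q + k * (t ^ 3 + t + 1)), ?_, ?_, ?_⟩ <;>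
      grind

/-- `d₁ ∘ d₂ = 0`, `d₂` is injective, and `ker(d₁)/im(d₂) ≅ R/((t²+t+1)³)` as `R`-modules:
the mod-2 Milnor-fiber torsion for `G₁₂` is `Φ₃³` with `Φ₃ = t²+t+1` the mod-2 reduction of
the third cyclotomic polynomial. -/
theorem milnor_fiber_complex_G12_mod_two :
    (∀ u v : RF, dtwo (u, v) = u • colOne + v • colTwo) ∧
    (∀ p q r : RF, done (p, q, r) = (T 1 + 1) * (p + q + r)) ∧
    done.comp dtwo = 0 ∧
    LinearMap.ker dtwo = ⊥ ∧
    ((Polynomial.cyclotomic 3 (ZMod 2)).toLaurent = (T 2 + T 1 + 1 : RF)) ∧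
    Nonempty ((LinearMap.ker done ⧸
        (LinearMap.range dtwo).comap (LinearMap.ker done).subtype) ≃ₗ[RF]
      RF ⧸ Ideal.span {((T 2 + T 1 + 1 : RF)) ^ 3}) := by
  refine ⟨dtwo_apply, done_apply, done_comp_dtwo, ker_dtwo, RF.toLaurent_cyclotomic_three, ?_⟩
  let I : Ideal RF := Ideal.span {(T 2 + T 1 + 1 : RF) ^ 3}
  let f : LinearMap.ker done →ₗ[RF] RF ⧸ I :=
    (Submodule.mkQ I).comp (annihilatorColTwo.comp (LinearMap.ker done).subtype)
  have hker : (LinearMap.range dtwo).comap (LinearMap.ker done).subtype = LinearMap.ker f := by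
    ext ⟨y, hy⟩
    simp only [f, I, Submodule.mem_comap, Submodule.subtype_apply, LinearMap.mem_ker,
      LinearMap.comp_apply, Submodule.mkQ_apply, Submodule.Quotient.mk_eq_zero,
      Ideal.mem_span_singleton, mem_range_dtwo_iff hy]
  have hf : Function.Surjective f := by
    intro z
    obtain ⟨x, rfl⟩ := Submodule.mkQ_surjective I z
    obtain ⟨y, hy, rfl⟩ := exists_mem_ker_done_annihilatorColTwo_eq x
    exact ⟨⟨y, hy⟩, rfl⟩
  exact ⟨(Submodule.quotEquivOfEq _ _ hker).trans (f.quotKerEquivOfSurjective hf)⟩
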